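/- Let n ≥ 1 and let f : (Fin n → Bool) → Bool be such that there is a unique j* with f(j*) = true. For j : Fin n → Bool and i : Fin n, let flip(i, j) denote j with its i-th bit negated. Define t₀ : (Fin n → Bool) → ((Fin n → Bool) × Bool) by t₀(j) = (j, f(j)), and for each step i = 0, 1, …, n−1 define t_{i+1}(j) = t_i(j) if (t_i(j)).2 = true, and t_{i+1}(j) = t_i(flip(i, j)) otherwise. Then after all n steps, t_n(j) = (j*, true) for every j : Fin n → Bool. -/

import Mathlib

/-- Combinatorial core of the nonlinear quantum search algorithm.
Given `f : (Fin n → Bool) → Bool` with a unique satisfying assignment `jstar`,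
the branch transformation `t` defined by `t 0 j = (j, f j)` and
`t (i+1) j = t i j` if the marker of `t i j` is `true`, else
`t (i+1) j = t i (flip i j)` (where `flip i j` negates bit `i`),
satisfies `t n j = (jstar, true)` for every branch `j`. -/
theorem nonlinear_search_correct (n : ℕ) (hn : 1 ≤ n)
    (f : (Fin n → Bool) → Bool)
    (jstar : Fin n → Bool) (hstar : f jstar = true)
    (huniq : ∀ j, f j = true → j = jstar)
    (t : ℕ → (Fin n → Bool) → ((Fin n → Bool) × Bool))
    (h0 : ∀ j, t 0 j = (j, f j))
    (hstep : ∀ (i : Fin n) (j : Fin n → Bool),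
      t (i.val + 1) j =
        if (t i.val j).2 = true then t i.val j
        else t i.val (Function.update j i (! j i))) :
    ∀ j, t n j = (jstar, true) := by
  have key : ∀ m ≤ n, ∀ j : Fin n → Bool,
      ((t m j).2 = true → t m j = (jstar, true)) ∧
      ((∀ k : Fin n, m ≤ k.val → j k = jstar k) → t m j = (jstar, true)) := by
    intro m
    induction m with
    | zero =>
      intro _ j
      rw [h0]
      refine ⟨fun h => Prod.ext (huniq j h) h, fun h => ?_⟩
      rw [funext fun k => h k (Nat.zero_le _), hstar]
    | succ m ih =>
      intro hm j
      have ih := ih (Nat.le_of_succ_le hm)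
      rw [hstep ⟨m, hm⟩ j]
      split_ifs with hmark
      · exact ⟨(ih j).1, fun _ => (ih j).1 hmark⟩
      · refine ⟨(ih _).1, fun hagree => (ih _).2 fun k hk => ?_⟩
        have hne : j ⟨m, hm⟩ ≠ jstar ⟨m, hm⟩ := by
          intro heq
          refine hmark (congrArg Prod.snd ((ih j).2 fun k hk => ?_))
          rcases hk.eq_or_lt with rfl | hlt
          · exact heq
          · exact hagree k hlt
        rcases hk.eq_or_lt with rfl | hlt
        · simpa [Bool.eq_not] using hne
        · rw [Function.update_of_ne (Fin.ne_of_val_ne hlt.ne')]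
          exact hagree k hlt
  exact fun j => (key n le_rfl j).2 fun k hk => absurd k.isLt hk.not_gt
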